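/- Let p ≥ 0 and let t = (t_1, …, t_{N+p+1}) be a knot vector of degree p (nondecreasing with t_i < t_{i+p+1} for all i). Then the B-splines of degree p over t span the full polynomial space of degree p on their domain: for every real polynomial q of degree at most p, there exist coefficients c_1, …, c_N ∈ ℝ such that q(x) = Σ_{i=1}^N c_i B_{i,p}(x) for all x ∈ [t_{p+1}, t_{N+1}). -/

import Mathlib

/-- The Cox–de Boor recursion defining the B-spline `B_{i,p}` of degree `p` with
index `i` over the knot sequence `t` (0-indexed): `bspline t i p` uses the knots
`t i, …, t (i+p+1)`.  Any term whose denominator vanishes is automatically `0`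
since division by zero is `0` in Lean. -/
noncomputable def bspline (t : ℕ → ℝ) : ℕ → ℕ → ℝ → ℝ
  | i, 0, x => if t i ≤ x ∧ x < t (i + 1) then 1 else 0
  | i, p + 1, x =>
      (x - t i) / (t (i + p + 1) - t i) * bspline t i p x +
        (t (i + p + 2) - x) / (t (i + p + 2) - t (i + 1)) * bspline t (i + 1) p x

/-- The B-spline `B_{i,p}` vanishes outside `[t i, t (i + p + 1))`. -/
lemma bspline_eq_zero {t : ℕ → ℝ} {M : ℕ} (hmono : ∀ i j, i ≤ j → j ≤ M → t i ≤ t j) {x : ℝ}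
    (p i : ℕ) (hi : i + p + 1 ≤ M) (hx : x < t i ∨ t (i + p + 1) ≤ x) :
    bspline t i p x = 0 := by
  induction p generalizing i with
  | zero =>
    rw [bspline, if_neg]
    rintro ⟨h₁, h₂⟩
    rcases hx with hx | hx
    · exact hx.not_ge h₁
    · exact hx.not_gt h₂
  | succ p ih =>
    have h₁ := hmono i (i + 1) (by omega) (by omega)
    have h₂ := hmono (i + p + 1) (i + (p + 1) + 1) (by omega) (by omega)
    have h₃ : i + 1 + p + 1 = i + (p + 1) + 1 := by omega
    rw [bspline, ih i (by omega) (hx.imp_right h₂.trans),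
      ih (i + 1) (by omega) (by rw [h₃]; exact hx.imp_left (lt_of_lt_of_le · h₁))]
    simp

lemma sum_bspline_zero {t : ℕ → ℝ} {x : ℝ} (hx : t 0 ≤ x) (N : ℕ)
    (hmono : ∀ i j, i ≤ j → j ≤ N → t i ≤ t j) :
    ∑ i ∈ Finset.range N, bspline t i 0 x = if x < t N then 1 else 0 := by
  induction N with
  | zero => simp [hx]
  | succ N ih =>
    have h := hmono N (N + 1) (by omega) le_rfl
    rw [Finset.sum_range_succ, ih fun i j hij hj => hmono i j hij (by omega), bspline]
    split_ifs <;> grind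

open Polynomial in
/-- Marsden's identity, as an identity of polynomials in the dual variable. -/
lemma marsden_identity {t : ℕ → ℝ} {x : ℝ} (p N : ℕ)
    (hmono : ∀ i j, i ≤ j → j ≤ N + p → t i ≤ t j) (hp : t p ≤ x) (hN : x < t N) :
    ∑ i ∈ Finset.range N, (∏ j ∈ Finset.range p, (X - C (t (i + 1 + j)))) * C (bspline t i p x) =
      (X - C x) ^ p := by
  induction p with
  | zero =>
    simp only [Finset.range_zero, Finset.prod_empty, one_mul, pow_zero]
    rw [← map_sum, sum_bspline_zero hp N hmono, if_pos hN, map_one]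
  | succ p ih =>
    let ψ (i : ℕ) : ℝ[X] := ∏ j ∈ Finset.range (p + 1), (X - C (t (i + j)))
    let g (i : ℕ) : ℝ[X] :=
      ψ i * C ((t (i + p + 1) - x) / (t (i + p + 1) - t i) * bspline t i p x)
    have g_zero : g 0 = 0 := by
      simp only [g]
      rw [bspline_eq_zero hmono p 0 (by omega) (Or.inr (by simpa using hp))]
      simp
    have g_last : g N = 0 := by
      simp only [g]
      rw [bspline_eq_zero hmono p N (by omega) (Or.inl hN)]
      simp
    have g_shift : ∑ i ∈ Finset.range N, g (i + 1) = ∑ i ∈ Finset.range N, g i := by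
      have h := (Finset.sum_range_succ g N).symm.trans (Finset.sum_range_succ' g N)
      rw [g_zero, g_last, add_zero, add_zero] at h
      exact h.symm
    have expand (i : ℕ) : ψ (i + 1) * C (bspline t i (p + 1) x) =
        ψ (i + 1) * C ((x - t i) / (t (i + p + 1) - t i) * bspline t i p x) + g (i + 1) := by
      have h : i + 1 + p + 1 = i + p + 2 := by omega
      simp only [g, bspline, h, C_add, mul_add]
    change ∑ i ∈ Finset.range N, ψ (i + 1) * C (bspline t i (p + 1) x) = _
    rw [Finset.sum_congr rfl fun i _ => expand i, Finset.sum_add_distrib, g_shift,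
      ← Finset.sum_add_distrib, pow_succ,
      ← ih (fun i j hij hj => hmono i j hij (by omega))
        ((hmono p (p + 1) (by omega) (by omega)).trans hp), Finset.sum_mul]
    refine Finset.sum_congr rfl fun i hi => ?_
    rw [Finset.mem_range] at hi
    have ψ_succ : ψ (i + 1) =
        (∏ j ∈ Finset.range p, (X - C (t (i + 1 + j)))) * (X - C (t (i + p + 1))) := by
      have h : i + 1 + p = i + p + 1 := by omega
      simp only [ψ, Finset.prod_range_succ, h]
    have ψ_eq : ψ i = (∏ j ∈ Finset.range p, (X - C (t (i + 1 + j)))) * (X - C (t i)) := by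
      have h (j : ℕ) : i + (j + 1) = i + 1 + j := by omega
      simp only [ψ]
      rw [Finset.prod_range_succ', add_zero, Finset.prod_congr rfl fun j _ => by rw [h j]]
    rcases (hmono i (i + p + 1) (by omega) (by omega)).eq_or_lt with heq | hlt
    · simp only [g]
      rw [bspline_eq_zero hmono p i (by omega) (by rw [← heq]; exact lt_or_ge _ _)]
      simp
    · have hne : t (i + p + 1) - t i ≠ 0 := (sub_pos.2 hlt).ne'
      simp only [g]
      rw [ψ_succ, ψ_eq]
      generalize t (i + p + 1) = b at *
      have hu : (b - x) / (b - t i) = 1 - (x - t i) / (b - t i) := by field_simp; ring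
      have hx : x = t i + (x - t i) / (b - t i) * (b - t i) := by field_simp; ring
      rw [hu]
      generalize (x - t i) / (b - t i) = w at *
      have hC : C x = C (t i) + C w * (C b - C (t i)) := by
        rw [← C_sub, ← C_mul, ← C_add, ← hx]
      rw [hC]
      simp only [C_mul, C_sub, C_1]
      ring

/-- Monomials of degree at most `p` are combinations of the B-splines of degree `p`. -/
lemma exists_pow_eq_sum_bspline (p N : ℕ) (t : ℕ → ℝ)
    (hmono : ∀ i j, i ≤ j → j ≤ N + p → t i ≤ t j) (m : ℕ) (hm : m ≤ p) :
    ∃ c : ℕ → ℝ, ∀ x : ℝ, t p ≤ x → x < t N →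
      x ^ m = ∑ i ∈ Finset.range N, c i * bspline t i p x := by
  refine ⟨fun i => ((-1) ^ m * (p.choose (p - m) : ℝ))⁻¹ *
    (∏ j ∈ Finset.range p, (Polynomial.X - Polynomial.C (t (i + 1 + j)))).coeff (p - m),
    fun x hp hN => ?_⟩
  have h := congrArg (Polynomial.coeff · (p - m)) (marsden_identity p N hmono hp hN)
  simp only [Polynomial.finsetSum_coeff, Polynomial.coeff_mul_C, sub_eq_add_neg,
    ← Polynomial.C_neg, Polynomial.coeff_X_add_C_pow] at h
  have hne : ((-1) ^ m * (p.choose (p - m) : ℝ)) ≠ 0 :=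
    mul_ne_zero (pow_ne_zero _ (by norm_num))
      (Nat.cast_ne_zero.2 (Nat.choose_pos (Nat.sub_le p m)).ne')
  simp only [mul_assoc _ (Polynomial.coeff _ _), ← Finset.mul_sum]
  simp only [sub_eq_add_neg, ← Polynomial.C_neg]
  rw [eq_inv_mul_iff_mul_eq₀ hne, h, Nat.sub_sub_self hm, neg_pow x]
  ring


/-- for a knot vector `t = (t_0, …, t_{N+p})` of degree `p`, the
B-splines of degree `p` span the full polynomial space of degree `p` on
`[t_p, t_N)` (1-based: `[t_{p+1}, t_{N+1})`): every real polynomial of degree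
at most `p` is a linear combination of `B_{0,p}, …, B_{N-1,p}` there. -/
theorem bspline_polynomial_reproduction (p N : ℕ) (t : ℕ → ℝ)
    (hmono : ∀ i j, i ≤ j → j ≤ N + p → t i ≤ t j)
    (hknot : ∀ i, i < N → t i < t (i + p + 1)) :
    ∀ q : Polynomial ℝ, q.natDegree ≤ p →
      ∃ c : ℕ → ℝ, ∀ x : ℝ, t p ≤ x → x < t N →
        q.eval x = ∑ i ∈ Finset.range N, c i * bspline t i p x := by
  intro q hq
  choose! c hc using exists_pow_eq_sum_bspline p N t hmono
  refine ⟨fun i => ∑ m ∈ Finset.range (p + 1), q.coeff m * c m i, fun x hp hN => ?_⟩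
  simp only [Finset.sum_mul]
  rw [Polynomial.eval_eq_sum_range' (Nat.lt_succ_of_le hq), Finset.sum_comm]
  refine Finset.sum_congr rfl fun m hm => ?_
  rw [hc m (Nat.lt_succ_iff.1 (Finset.mem_range.1 hm)) x hp hN, Finset.mul_sum]
  simp only [mul_assoc]
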